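/- (Fixed Point Trace Representation in Language) Fix a binary relation R on State, a recursion variable X, a valuation V, and a chop formula Ψ ∈ CF_{(R,X)}. Writing c_l for the primitive chop formula R⌢…⌢R (l copies of R, l ≥ 1), one has ⟦μX.Ψ⟧_V = ⋃ { ⟦c_l⟧_V | l ≥ 1 and the word R^l ∈ L(gr(Ψ)) }; in particular, a trace σ lies in ⟦μX.Ψ⟧_V if and only if σ ∈ ⟦c_l⟧_V for some l ≥ 1 with R^l ∈ L(gr(Ψ)). -/

import Mathlib

/-- A trace is a nonempty finite list of states (an element of `State⁺`). -/
abbrev Trace (State : Type) : Type := {l : List State // l ≠ []}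

/-- Trace formulas: `Φ ::= p | R | Φ∧Φ | Φ∨Φ | Φ⌢Φ | X | μX.Φ`. -/
inductive TF (State RVar : Type) : Type where
  | pred : (State → Prop) → TF State RVar
  | rel  : (State → State → Prop) → TF State RVar
  | conj : TF State RVar → TF State RVar → TF State RVar
  | disj : TF State RVar → TF State RVar → TF State RVar
  | chop : TF State RVar → TF State RVar → TF State RVar
  | var  : RVar → TF State RVar
  | mu   : RVar → TF State RVar → TF State RVar

/-- Chop of trace sets: `A ⋈ B = {σ·s·σ' | σ·s ∈ A ∧ s·σ' ∈ B}`,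
the two parts overlapping in the single shared state `s`. -/
def chopSet {State : Type} (A B : Set (Trace State)) : Set (Trace State) :=
  {t | ∃ (σ σ' : List State) (s : State),
    t.1 = σ ++ s :: σ' ∧
    (⟨σ ++ [s], by simp⟩ : Trace State) ∈ A ∧
    (⟨s :: σ', by simp⟩ : Trace State) ∈ B}

/-- Semantics of trace formulas under a valuation `V : RVar → 𝒫(State⁺)`. -/
def sem {State RVar : Type} [DecidableEq RVar] :
    TF State RVar → (RVar → Set (Trace State)) → Set (Trace State)
  | TF.pred p, _ => {t | ∃ (s : State) (σ : List State), t.1 = s :: σ ∧ p s}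
  | TF.rel R, _ => {t | ∃ s s', t.1 = [s, s'] ∧ R s s'}
  | TF.conj a b, V => sem a V ∩ sem b V
  | TF.disj a b, V => sem a V ∪ sem b V
  | TF.chop a b, V => chopSet (sem a V) (sem b V)
  | TF.var X, V => V X
  | TF.mu X a, V => ⋂₀ {γ : Set (Trace State) | sem a (Function.update V X γ) ⊆ γ}

/-- Atoms of primitive chop formulas over a fixed relation `R`
and recursion variable `X`: either `R` or `X`. A primitive chop formula
`S₁⌢…⌢S_k` is a (nonempty) list of atoms; since `grammatize` sends it to
the word `S₁S₂⋯S_k` over terminal `R` and nonterminal `X`, words of the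
grammar are lists of atoms as well. -/
inductive Atom : Type where
  | r : Atom
  | x : Atom
deriving DecidableEq

/-- The trace formula denoted by an atom. -/
def Atom.toTF {State RVar : Type} (R : State → State → Prop) (X : RVar) :
    Atom → TF State RVar
  | Atom.r => TF.rel R
  | Atom.x => TF.var X

/-- The trace formula `S₁⌢…⌢S_k` denoted by a primitive chop formula
(the empty list is mapped to a junk formula with empty semantics). -/
def pcfToTF {State RVar : Type} (R : State → State → Prop) (X : RVar) :
    List Atom → TF State RVar
  | [] => TF.pred fun _ => False
  | [a] => a.toTF R X
  | a :: b :: rest => TF.chop (a.toTF R X) (pcfToTF R X (b :: rest))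

/-- The trace formula `⋁_{1≤j≤n} φ_j` denoted by a chop formula, i.e. by a
finite disjunction of primitive chop formulas. -/
def cfToTF {State RVar : Type} (R : State → State → Prop) (X : RVar) :
    List (List Atom) → TF State RVar
  | [] => TF.pred fun _ => False
  | [c] => pcfToTF R X c
  | c :: d :: rest => TF.disj (pcfToTF R X c) (cfToTF R X (d :: rest))

/-- `SubstX S φ ψ`: `ψ` is obtained from `φ` by replacing each occurrence of
the atom `X` by some (possibly different) element of `S`. -/
inductive SubstX (S : Set (List Atom)) : List Atom → List Atom → Prop where
  | nil : SubstX S [] []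
  | r {φ ψ : List Atom} : SubstX S φ ψ → SubstX S (Atom.r :: φ) (Atom.r :: ψ)
  | x {φ ψ : List Atom} (c : List Atom) :
      c ∈ S → SubstX S φ ψ → SubstX S (Atom.x :: φ) (c ++ ψ)

/-- Derivability of sentential forms in the grammar `gr(Ψ)` with single
nonterminal `X`, single terminal `R`, initial nonterminal `X`, and one
production `X → S₁⋯S_k` for each disjunct `S₁⌢…⌢S_k` of `Ψ`. -/
inductive Derives (Ψ : List (List Atom)) : List Atom → Prop where
  | start : Derives Ψ [Atom.x]
  | step {u v c : List Atom} :
      c ∈ Ψ → Derives Ψ (u ++ Atom.x :: v) → Derives Ψ (u ++ c ++ v)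

/-- `L(gr(Ψ)) ⊆ {R}*`: the terminal words derivable from `X` in `gr(Ψ)`. -/
def Lang (Ψ : List (List Atom)) : Set (List Atom) :=
  {w | Derives Ψ w ∧ Atom.x ∉ w}

/-- Singleton traces: the unit of `chopSet`. -/
def unitSet (State : Type) : Set (Trace State) := {t | ∃ s, t.1 = [s]}

theorem chopSet_unit {State : Type} (A : Set (Trace State)) :
    chopSet A (unitSet State) = A := by
  ext ⟨t, ht⟩
  constructor
  · rintro ⟨σ, σ', s, h, hA, s', hs'⟩
    simp only [List.cons.injEq] at hs' h
    obtain ⟨rfl, rfl⟩ := hs'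
    subst h
    exact hA
  · intro h
    obtain ⟨σ, s, rfl⟩ : ∃ σ s, t = σ ++ [s] :=
      ⟨t.dropLast, t.getLast ht, (List.dropLast_append_getLast ht).symm⟩
    exact ⟨σ, [], s, rfl, h, s, rfl⟩

theorem unit_chopSet {State : Type} (A : Set (Trace State)) :
    chopSet (unitSet State) A = A := by
  ext ⟨t, ht⟩
  constructor
  · rintro ⟨σ, σ', s, h, ⟨s', hs'⟩, hA⟩
    have : σ = [] := by
      cases σ <;> simp_all
    subst this
    simp only [List.nil_append] at h
    subst h
    exact hA
  · intro h
    cases t with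
    | nil => exact absurd rfl ht
    | cons s σ => exact ⟨[], σ, s, rfl, ⟨s, rfl⟩, h⟩

theorem chopSet_assoc {State : Type} (A B C : Set (Trace State)) :
    chopSet (chopSet A B) C = chopSet A (chopSet B C) := by
  ext ⟨t, ht⟩
  constructor
  · rintro ⟨σ, σ', s, h, ⟨τ, τ', r, h2, hA, hB⟩, hC⟩
    simp only at h h2
    rcases List.eq_nil_or_concat τ' with rfl | ⟨ρ, z, rfl⟩
    · obtain ⟨rfl, h3⟩ := List.append_inj' h2 rfl
      obtain rfl : s = r := by simpa using h3
      exact ⟨σ, σ', s, h, hA, [], σ', s, rfl, hB, hC⟩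
    · have h3 : σ ++ [s] = (τ ++ r :: ρ) ++ [z] := by simpa using h2
      obtain ⟨rfl, h4⟩ := List.append_inj' h3 rfl
      obtain rfl : s = z := by simpa using h4
      refine ⟨τ, ρ ++ s :: σ', r, by simpa using h, hA, r :: ρ, σ', s, by simp, ?_, hC⟩
      simpa using hB
  · rintro ⟨σ, σ', s, h, hA, ⟨τ, τ', r, h2, hB, hC⟩⟩
    simp only at h h2
    cases τ with
    | nil =>
      simp only [List.nil_append, List.cons.injEq] at h2
      obtain ⟨rfl, rfl⟩ := h2
      exact ⟨σ, σ', s, h, ⟨σ, [], s, rfl, hA, hB⟩, hC⟩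
    | cons z ρ =>
      simp only [List.cons_append, List.cons.injEq] at h2
      obtain ⟨rfl, rfl⟩ := h2
      exact ⟨σ ++ s :: ρ, τ', r, by simpa using h, ⟨σ, ρ ++ [r], s, by simp, hA, hB⟩, hC⟩

theorem chopSet_mono {State : Type} {A A' B B' : Set (Trace State)} (h : A ⊆ A') (h' : B ⊆ B') :
    chopSet A B ⊆ chopSet A' B' := by
  rintro t ⟨σ, σ', s, e, hA, hB⟩
  exact ⟨σ, σ', s, e, h hA, h' hB⟩

/-- Trace semantics of an atom, `X` being interpreted by `G`. -/
def atomSem {State : Type} (R : State → State → Prop) (G : Set (Trace State)) :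
    Atom → Set (Trace State)
  | Atom.r => {t | ∃ s s', t.1 = [s, s'] ∧ R s s'}
  | Atom.x => G

/-- Trace semantics of a word. -/
def wordSem {State : Type} (R : State → State → Prop) (G : Set (Trace State)) :
    List Atom → Set (Trace State)
  | [] => unitSet State
  | a :: w => chopSet (atomSem R G a) (wordSem R G w)

theorem wordSem_append {State : Type} (R : State → State → Prop) (G : Set (Trace State))
    (u v : List Atom) :
    wordSem R G (u ++ v) = chopSet (wordSem R G u) (wordSem R G v) := by
  induction u with
  | nil => simp [wordSem, unit_chopSet]
  | cons a u ih => simp [wordSem, ih, chopSet_assoc]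

theorem sem_atom {State RVar : Type} [DecidableEq RVar] (R : State → State → Prop) (X : RVar)
    (V : RVar → Set (Trace State)) (a : Atom) :
    sem (a.toTF R X) V = atomSem R (V X) a := by
  cases a <;> simp [Atom.toTF, sem, atomSem]

theorem sem_pcf {State RVar : Type} [DecidableEq RVar] (R : State → State → Prop) (X : RVar)
    (V : RVar → Set (Trace State)) (w : List Atom) (hw : w ≠ []) :
    sem (pcfToTF R X w) V = wordSem R (V X) w := by
  induction w with
  | nil => exact absurd rfl hw
  | cons a w ih =>
    cases w with
    | nil => simp [pcfToTF, sem_atom, wordSem, chopSet_unit]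
    | cons b w =>
      rw [pcfToTF, sem, ih (by simp), sem_atom]
      rfl

theorem mem_sem_cf {State RVar : Type} [DecidableEq RVar] (R : State → State → Prop) (X : RVar)
    (V : RVar → Set (Trace State)) (Ψ : List (List Atom)) (hΨ : Ψ ≠ []) (t : Trace State) :
    t ∈ sem (cfToTF R X Ψ) V ↔ ∃ c ∈ Ψ, t ∈ sem (pcfToTF R X c) V := by
  induction Ψ with
  | nil => exact absurd rfl hΨ
  | cons a w ih =>
    cases w with
    | nil => simp [cfToTF]
    | cons b w =>
      rw [cfToTF, sem, Set.mem_union, ih (by simp)]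
      simp only [List.mem_cons, exists_eq_or_imp]

theorem wordSem_replicate {State : Type} (R : State → State → Prop) (G G' : Set (Trace State))
    (l : ℕ) : wordSem R G (List.replicate l Atom.r) = wordSem R G' (List.replicate l Atom.r) := by
  induction l with
  | zero => rfl
  | succ l ih => simp only [List.replicate_succ, wordSem, ih]; rfl

theorem wordSem_derives {State : Type} (R : State → State → Prop) (G : Set (Trace State))
    (Ψ : List (List Atom)) (hG : ∀ c ∈ Ψ, wordSem R G c ⊆ G) {w : List Atom}
    (h : Derives Ψ w) : wordSem R G w ⊆ G := by
  induction h with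
  | start => simp [wordSem, chopSet_unit, atomSem]
  | @step u v c hc _ ih =>
    refine subset_trans ?_ ih
    rw [wordSem_append, wordSem_append, wordSem_append, chopSet_assoc]
    exact chopSet_mono subset_rfl (chopSet_mono (hG c hc) subset_rfl)

theorem derives_ctx {Ψ : List (List Atom)} {w : List Atom} (h : Derives Ψ w) (u v : List Atom)
    (huv : Derives Ψ (u ++ Atom.x :: v)) : Derives Ψ (u ++ w ++ v) := by
  induction h with
  | start => simpa using huv
  | @step a b c hc _ ih =>
    have := Derives.step (u := u ++ a) (v := b ++ v) hc (by simpa using ih)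
    simpa using this

theorem wordSem_expand {State : Type} (R : State → State → Prop) (G₀ : Set (Trace State))
    (Ψ : List (List Atom)) (c : List Atom) (t : Trace State)
    (ht : t ∈ wordSem R {t | ∃ l : ℕ, 1 ≤ l ∧ List.replicate l Atom.r ∈ Lang Ψ ∧
        t ∈ wordSem R G₀ (List.replicate l Atom.r)} c) :
    ∃ l : ℕ, (c ≠ [] → 1 ≤ l) ∧ t ∈ wordSem R G₀ (List.replicate l Atom.r) ∧
      ∀ u v, Derives Ψ (u ++ c ++ v) → Derives Ψ (u ++ List.replicate l Atom.r ++ v) := by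
  induction c generalizing t with
  | nil => exact ⟨0, by simp, ht, fun u v h => h⟩
  | cons a w ih =>
    obtain ⟨σ, σ', s, e, hA, hB⟩ := ht
    obtain ⟨l, -, hl, hd⟩ := ih _ hB
    cases a with
    | r =>
      refine ⟨l + 1, by simp, ⟨σ, σ', s, e, hA, hl⟩, fun u v h => ?_⟩
      have := hd (u ++ [Atom.r]) v (by simpa using h)
      simpa [List.replicate_succ] using this
    | x =>
      obtain ⟨k, hk, hkL, hkt⟩ := hA
      refine ⟨k + l, fun _ => by omega, ?_, fun u v h => ?_⟩
      · rw [List.replicate_add, wordSem_append]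
        exact ⟨σ, σ', s, e, hkt, hl⟩
      · have h1 := derives_ctx hkL.1 u (w ++ v) (by simpa using h)
        have := hd (u ++ List.replicate k Atom.r) v (by simpa using h1)
        rw [List.replicate_add, ← List.append_assoc]
        exact this

/-- Fixed Point Trace Representation in Language:
`⟦μX.Ψ⟧_V = ⋃ {⟦c_l⟧_V | l ≥ 1 ∧ R^l ∈ L(gr(Ψ))}` where `c_l` is the
primitive chop formula `R⌢…⌢R` (`l` copies of `R`); in particular a trace
lies in `⟦μX.Ψ⟧_V` iff it lies in some such `⟦c_l⟧_V`. -/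
theorem mu_cf_eq_lang_union {State RVar : Type} [DecidableEq RVar]
    (R : State → State → Prop) (X : RVar) (V : RVar → Set (Trace State))
    (Ψ : List (List Atom)) (hΨ : Ψ ≠ []) (hpcf : ∀ c ∈ Ψ, c ≠ []) :
    sem (TF.mu X (cfToTF R X Ψ)) V =
      {t | ∃ l : ℕ, 1 ≤ l ∧ List.replicate l Atom.r ∈ Lang Ψ ∧
        t ∈ sem (pcfToTF R X (List.replicate l Atom.r)) V} := by
  have hrep : ∀ l : ℕ, 1 ≤ l → ∀ G : Set (Trace State),
      sem (pcfToTF R X (List.replicate l Atom.r)) V = wordSem R G (List.replicate l Atom.r) := by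
    intro l hl G
    rw [sem_pcf _ _ _ _ (by simp; omega)]
    exact wordSem_replicate R _ _ l
  apply Set.Subset.antisymm
  · rw [sem]
    refine Set.sInter_subset_of_mem ?_
    intro t ht
    rw [mem_sem_cf _ _ _ _ hΨ] at ht
    obtain ⟨c, hc, ht⟩ := ht
    rw [sem_pcf _ _ _ _ (hpcf c hc), Function.update_self] at ht
    have hset : {t | ∃ l : ℕ, 1 ≤ l ∧ List.replicate l Atom.r ∈ Lang Ψ ∧
        t ∈ sem (pcfToTF R X (List.replicate l Atom.r)) V} =
        {t | ∃ l : ℕ, 1 ≤ l ∧ List.replicate l Atom.r ∈ Lang Ψ ∧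
        t ∈ wordSem R (V X) (List.replicate l Atom.r)} := by
      ext t
      refine exists_congr fun l => and_congr_right fun hl => ?_
      rw [hrep l hl (V X)]
    rw [hset] at ht ⊢
    obtain ⟨l, hl, hlt, hd⟩ := wordSem_expand R (V X) Ψ c t ht
    refine ⟨l, hl (hpcf c hc), ⟨?_, by simp [List.mem_replicate]⟩, hlt⟩
    have h1 : Derives Ψ ([] ++ c ++ []) := Derives.step hc Derives.start
    simpa using hd [] [] h1
  · rintro t ⟨l, hl, hL, ht⟩
    rw [sem]
    intro G hG
    rw [hrep l hl G] at ht
    refine wordSem_derives R G Ψ ?_ hL.1 ht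
    intro c hc t' ht'
    apply hG
    rw [mem_sem_cf _ _ _ _ hΨ]
    refine ⟨c, hc, ?_⟩
    rw [sem_pcf _ _ _ _ (hpcf c hc), Function.update_self]
    exact ht'
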